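/- Let 𝒫 be a Beurling generalized prime system, ρ > 0, and α, β ∈ [0,1) such that for every ε > 0, ψ_𝒫(x) = x + O(x^{α+ε}) and N_𝒫(x) = ρx + O(x^{β+ε}); set Θ = max{α, β}. Then there exists a zero-free holomorphic function Z on Ω = {s ∈ ℂ : Re s > Θ} ∖ {1} agreeing with Σ_e (∏ᵢ pᵢ^{e i})^{−s} for Re s > 1, such that for every δ > 0 and ε > 0 there is a constant C with |Z(σ + it)| ≤ C·exp((log |t|)^{(1−σ)/(1−Θ)+ε}) and |1/Z(σ + it)| ≤ C·exp((log |t|)^{(1−σ)/(1−Θ)+ε}) for all σ ≥ Θ + δ and |t| ≥ 2. In particular, for every σ > Θ and every ε > 0, both Z(σ + it) and 1/Z(σ + it) are O(|t|^ε) as |t| → ∞. -/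

import Mathlib

open Filter Asymptotics

/-- ψ_𝒫(x): sum of log pᵢ over pairs (i,k) with k ≥ 1 and pᵢ^k ≤ x. -/
noncomputable def psiP (p : ℕ → ℝ) (x : ℝ) : ℝ :=
  ∑ᶠ ik ∈ {ik : ℕ × ℕ | 1 ≤ ik.2 ∧ p ik.1 ^ ik.2 ≤ x}, Real.log (p ik.1)

/-- N_𝒫(x): number of finitely supported e : ℕ → ℕ with ∏ pᵢ^{e i} ≤ x. -/
noncomputable def NP (p : ℕ → ℝ) (x : ℝ) : ℕ :=
  Nat.card {e : ℕ →₀ ℕ | ∏ i ∈ e.support, p i ^ e i ≤ x}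

/-- The statement that Z agrees with the Beurling zeta series Σ_e (∏ pᵢ^{e i})^{-s}
for Re s > 1, in the sense that the series sums to Z s there. -/
def AgreesWithZeta (p : ℕ → ℝ) (Z : ℂ → ℂ) : Prop :=
  ∀ s : ℂ, 1 < s.re →
    HasSum (fun e : ℕ →₀ ℕ => ((∏ i ∈ e.support, p i ^ e i : ℝ) : ℂ) ^ (-s)) (Z s)

open MeasureTheory Set in
lemma int_real (n σ : ℝ) (hn : 1 ≤ n) (hσ : 0 < σ) :
    IntegrableOn (fun x : ℝ => if n ≤ x then x ^ (-σ - 1) else 0) (Ioi 1) ∧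
    ∫ x in Ioi (1:ℝ), (if n ≤ x then x ^ (-σ - 1) else 0) = n ^ (-σ) / σ := by
  have h1 : (fun x : ℝ => if n ≤ x then x ^ (-σ - 1) else 0)
      = (Ici n).indicator (fun x => x ^ (-σ - 1)) := by
    ext x; simp [Set.indicator]
  have hae : (Ici n ∩ Ioi 1 : Set ℝ) =ᵐ[volume] Ioi n := by
    have : (Ioi n : Set ℝ) = Ioi n ∩ Ioi 1 := by
      ext x; simp; intro h; linarith
    rw [this]
    exact (Ioi_ae_eq_Ici.symm).inter (ae_eq_refl _)
  constructor
  · rw [h1, IntegrableOn, integrable_indicator_iff measurableSet_Ici, IntegrableOn,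
      Measure.restrict_restrict measurableSet_Ici]
    exact (integrableOn_Ioi_rpow_of_lt (by linarith) (by linarith)).congr_set_ae hae
  · rw [h1, integral_indicator measurableSet_Ici, Measure.restrict_restrict measurableSet_Ici,
      setIntegral_congr_set hae, integral_Ioi_rpow_of_lt (by linarith) (by linarith)]
    rw [show -σ - 1 + 1 = -σ by ring, neg_div_neg_eq]

open MeasureTheory Set in
lemma int_cpx (n : ℝ) (s : ℂ) (hn : 1 ≤ n) (hσ : 0 < s.re) :
    IntegrableOn (fun x : ℝ => if n ≤ x then (x:ℂ) ^ (-s - 1) else 0) (Ioi 1) ∧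
    ∫ x in Ioi (1:ℝ), (if n ≤ x then (x:ℂ) ^ (-s - 1) else 0) = (n:ℂ) ^ (-s) / s := by
  have h1 : (fun x : ℝ => if n ≤ x then (x:ℂ) ^ (-s - 1) else 0)
      = (Ici n).indicator (fun x : ℝ => (x:ℂ) ^ (-s - 1)) := by
    ext x; simp [Set.indicator]
  have hae : (Ici n ∩ Ioi 1 : Set ℝ) =ᵐ[volume] Ioi n := by
    have : (Ioi n : Set ℝ) = Ioi n ∩ Ioi 1 := by
      ext x; simp; intro h; linarith
    rw [this]
    exact (Ioi_ae_eq_Ici.symm).inter (ae_eq_refl _)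
  constructor
  · rw [h1, IntegrableOn, integrable_indicator_iff measurableSet_Ici, IntegrableOn,
      Measure.restrict_restrict measurableSet_Ici]
    exact (integrableOn_Ioi_cpow_of_lt (by simp; linarith) (by linarith)).congr_set_ae hae
  · rw [h1, integral_indicator measurableSet_Ici, Measure.restrict_restrict measurableSet_Ici,
      setIntegral_congr_set hae, integral_Ioi_cpow_of_lt (by simp; linarith) (by linarith)]
    rw [show -s - 1 + 1 = -s by ring, neg_div_neg_eq]

lemma A_bound (A : ℝ → ℝ) (hmono : Monotone A) (hpos : ∀ x, 0 ≤ A x) (ρ γ : ℝ) (hγ0 : 0 ≤ γ)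
    (hO : (fun x => A x - ρ * x) =O[atTop] fun x => x ^ γ) :
    ∃ C : ℝ, 0 ≤ C ∧ ∀ x, 1 ≤ x → |A x - ρ * x| ≤ C * x ^ γ := by
  obtain ⟨C0, h0⟩ := hO.bound
  obtain ⟨T0, hT0⟩ := eventually_atTop.1 h0
  set T := max T0 1
  have hT : 1 ≤ T := le_max_right _ _
  refine ⟨|C0| + A T + |ρ| * T, by have := hpos T; positivity, fun x hx => ?_⟩
  have hx1 : 1 ≤ x ^ γ := Real.one_le_rpow hx hγ0
  have hAT := hpos T
  by_cases h : T ≤ x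
  · have := hT0 x ((le_max_left _ _).trans h)
    rw [Real.norm_eq_abs, Real.norm_eq_abs, abs_of_nonneg (a := x ^ γ) (by positivity)] at this
    refine this.trans (mul_le_mul_of_nonneg_right ?_ (by positivity))
    have : 0 ≤ |ρ| * T := by positivity
    linarith [le_abs_self C0]
  · push Not at h
    have h1 : |A x - ρ * x| ≤ A T + |ρ| * T := by
      calc |A x - ρ * x| ≤ |A x| + |ρ * x| := abs_sub _ _
        _ = A x + |ρ| * x := by rw [abs_of_nonneg (hpos x), abs_mul, abs_of_pos (by linarith : 0 < x)]
        _ ≤ _ := by gcongr; exact hmono h.le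
    calc |A x - ρ * x| ≤ (|C0| + A T + |ρ| * T) * 1 := by linarith [abs_nonneg C0]
      _ ≤ _ := by gcongr

open MeasureTheory Set in
lemma mellin_lemma {ι : Type*} [Countable ι] (n w : ι → ℝ) (hn : ∀ j, 1 ≤ n j)
    (hw : ∀ j, 0 ≤ w j) (A : ℝ → ℝ)
    (hA : ∀ x, HasSum (fun j => if n j ≤ x then w j else 0) (A x)) (ρ γ : ℝ)
    (hγ0 : 0 ≤ γ) (hγ : γ < 1)
    (hO : ∀ ε > 0, (fun x => A x - ρ * x) =O[atTop] fun x => x ^ (γ + ε)) :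
    (∀ σ : ℝ, 1 < σ → Summable (fun j => w j * n j ^ (-σ))) ∧
    ∃ E : ℂ → ℂ, DifferentiableOn ℂ E {s | γ < s.re} ∧
      (∀ δ > 0, ∃ C, ∀ s : ℂ, γ + δ ≤ s.re → ‖E s‖ ≤ C) ∧
      ∀ s : ℂ, 1 < s.re →
        HasSum (fun j => (w j : ℂ) * (n j : ℂ) ^ (-s)) (ρ * s / (s - 1) + s * E s) := by
  have hpos : ∀ x, 0 ≤ A x := fun x => (hA x).nonneg fun j => by split_ifs <;> simp [hw]
  have hmono : Monotone A := fun x y hxy => hasSum_le (fun j => by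
    split_ifs with h1 h2
    · exact le_rfl
    · exact absurd (h1.trans hxy) h2
    · exact hw j
    · exact le_rfl) (hA x) (hA y)
  have hmeas : Measurable A := hmono.measurable
  have hB : ∀ ε > 0, ∃ C : ℝ, 0 ≤ C ∧ ∀ x, 1 ≤ x → |A x - ρ * x| ≤ C * x ^ (γ + ε) :=
    fun ε hε => A_bound A hmono hpos ρ (γ + ε) (by linarith) (hO ε hε)
  -- integrability of the error term
  have hIE : ∀ s : ℂ, γ < s.re →
      IntegrableOn (fun x : ℝ => ((A x - ρ * x : ℝ) : ℂ) * (x : ℂ) ^ (-s - 1)) (Ioi 1) := by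
    intro s hs
    obtain ⟨C, hC0, hC⟩ := hB ((s.re - γ) / 2) (by linarith)
    refine Integrable.mono' (g := fun x : ℝ => C * x ^ ((γ - s.re) / 2 - 1)) ?_ ?_ ?_
    · exact (integrableOn_Ioi_rpow_of_lt (by linarith) (by norm_num)).const_mul C
    · apply Measurable.aestronglyMeasurable
      fun_prop
    · filter_upwards [ae_restrict_mem measurableSet_Ioi] with x hx
      have hx1 : (1:ℝ) < x := hx
      have hx0 : (0:ℝ) < x := by linarith
      rw [norm_mul, Complex.norm_real, Complex.norm_cpow_eq_rpow_re_of_pos hx0, Real.norm_eq_abs]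
      calc _ ≤ (C * x ^ (γ + (s.re - γ) / 2)) * x ^ ((-s - 1).re) := by
            gcongr; exact hC x hx1.le
        _ = _ := by
            rw [mul_assoc, ← Real.rpow_add hx0]; simp; left; congr 1; ring
  have hIlin : ∀ s : ℂ, 1 < s.re →
      IntegrableOn (fun x : ℝ => (ρ : ℂ) * (x : ℂ) ^ (-s)) (Ioi 1) := fun s hs =>
    (integrableOn_Ioi_cpow_of_lt (by simpa using hs) (by norm_num)).const_mul _
  have hsplit : ∀ s : ℂ, ∀ x : ℝ, x ∈ Ioi (1:ℝ) → (A x : ℂ) * (x:ℂ) ^ (-s - 1) =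
      ρ * (x : ℂ) ^ (-s) + ((A x - ρ * x : ℝ) : ℂ) * (x : ℂ) ^ (-s - 1) := by
    intro s x hx
    have hx0 : (x:ℂ) ≠ 0 := by
      have : (1:ℝ) < x := hx
      exact_mod_cast (by linarith : (0:ℝ) < x).ne'
    rw [Complex.cpow_sub _ _ hx0, Complex.cpow_one]
    push_cast
    field_simp
    ring
  have hIA : ∀ s : ℂ, 1 < s.re →
      IntegrableOn (fun x : ℝ => (A x : ℂ) * (x : ℂ) ^ (-s - 1)) (Ioi 1) := by
    intro s hs
    refine ((hIlin s hs).add (hIE s (by linarith))).congr ?_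
    filter_upwards [ae_restrict_mem measurableSet_Ioi] with x hx
    exact (hsplit s x hx).symm
  have hsum : ∀ σ : ℝ, 1 < σ → Summable (fun j => w j * n j ^ (-σ)) := by
    intro σ hσ
    have hIr : IntegrableOn (fun x : ℝ => A x * x ^ (-σ - 1)) (Ioi 1) := by
      refine (hIA σ (by simpa using hσ)).norm.congr ?_
      filter_upwards [ae_restrict_mem measurableSet_Ioi] with x hx
      have hx0 : (0:ℝ) < x := lt_trans one_pos hx
      rw [norm_mul, Complex.norm_real, Complex.norm_cpow_eq_rpow_re_of_pos hx0, Real.norm_eq_abs,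
        abs_of_nonneg (hpos x)]
      simp
    refine summable_of_sum_le (c := σ * ∫ x in Ioi (1:ℝ), A x * x ^ (-σ - 1))
      (fun j => mul_nonneg (hw j) (Real.rpow_nonneg (by linarith [hn j]) _)) fun F => ?_
    have : ∑ j ∈ F, w j * n j ^ (-σ) = σ * ∫ x in Ioi (1:ℝ),
        ∑ j ∈ F, w j * (if n j ≤ x then x ^ (-σ - 1) else 0) := by
      rw [integral_finsetSum _ fun j _ => ((int_real (n j) σ (hn j) (by linarith)).1).const_mul _,
        Finset.mul_sum]
      refine Finset.sum_congr rfl fun j _ => ?_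
      rw [integral_const_mul, (int_real (n j) σ (hn j) (by linarith)).2]
      field_simp
    rw [this]
    refine mul_le_mul_of_nonneg_left ?_ (by linarith)
    refine setIntegral_mono_on ?_ hIr measurableSet_Ioi ?_
    · exact integrable_finsetSum _ fun j _ =>
        ((int_real (n j) σ (hn j) (by linarith)).1).const_mul _
    · intro x hx
      have hx0 : (0:ℝ) < x := lt_trans one_pos hx
      have h1 := sum_le_hasSum F (fun j _ => by split_ifs <;> simp [hw]) (hA x)
      calc _ = (∑ j ∈ F, if n j ≤ x then w j else 0) * x ^ (-σ - 1) := by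
            rw [Finset.sum_mul]; refine Finset.sum_congr rfl fun j _ => ?_
            split_ifs <;> simp
        _ ≤ _ := by gcongr
  refine ⟨hsum, fun s => mellin (fun x : ℝ => if 1 < x then ((A x - ρ * x : ℝ) : ℂ) else 0) (-s),
    ?_, ?_, ?_⟩
  · intro s hs
    have hs' : γ < s.re := hs
    apply DifferentiableAt.differentiableWithinAt
    have : DifferentiableAt ℂ
        (mellin (fun x : ℝ => if 1 < x then ((A x - ρ * x : ℝ) : ℂ) else 0)) (-s) := by
      refine mellin_differentiableAt_of_isBigO_rpow (a := -(γ + (s.re - γ) / 2)) (b := -s.re - 1)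
        ?_ ?_ ?_ ?_ ?_
      · apply LocallyIntegrable.locallyIntegrableOn
        have h1 : (fun x : ℝ => if 1 < x then ((A x - ρ * x : ℝ) : ℂ) else 0) =
          (Ioi 1).indicator (fun x : ℝ => ((A x - ρ * x : ℝ) : ℂ)) := by
            ext x; simp [Set.indicator]
        rw [h1]
        have h2 : LocallyIntegrable (fun x : ℝ => A x - ρ * x) :=
          hmono.locallyIntegrable.sub ((continuous_const.mul continuous_id).locallyIntegrable)
        have h3 : LocallyIntegrable (fun x : ℝ => ((A x - ρ * x : ℝ) : ℂ)) := by
          intro x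
          obtain ⟨U, hU, hi⟩ := h2 x
          exact ⟨U, hU, hi.ofReal⟩
        exact h3.indicator measurableSet_Ioi
      · have := hO ((s.re - γ) / 2) (by linarith)
        simp only [neg_neg]
        refine IsBigO.trans (IsBigO.of_bound 1 ?_) this
        filter_upwards [eventually_gt_atTop 1] with x hx
        rw [if_pos hx, Complex.norm_real, one_mul]
      · simp; linarith
      · refine IsBigO.of_bound 1 ?_
        have : Iio (1:ℝ) ∈ nhdsWithin (0:ℝ) (Ioi 0) :=
          mem_nhdsWithin_of_mem_nhds (Iio_mem_nhds one_pos)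
        filter_upwards [this] with x hx
        have : ¬ (1 < x) := not_lt.2 (le_of_lt hx)
        rw [if_neg this]; simp
      · simp
    exact this.comp s differentiableAt_id.neg
  all_goals
    have hE : ∀ s : ℂ,
      mellin (fun x : ℝ => if 1 < x then ((A x - ρ * x : ℝ) : ℂ) else 0) (-s) =
        ∫ x in Ioi (1:ℝ), ((A x - ρ * x : ℝ) : ℂ) * (x : ℂ) ^ (-s - 1) := by
      intro s
      rw [mellin]
      have h1 : (fun t : ℝ => (t:ℂ) ^ (-s - 1) • (if 1 < t then ((A t - ρ * t : ℝ) : ℂ) else 0)) =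
          (Ioi 1).indicator (fun x : ℝ => ((A x - ρ * x : ℝ) : ℂ) * (x : ℂ) ^ (-s - 1)) := by
        ext x
        by_cases h : 1 < x
        · simp [h, mul_comm]
        · simp [h]
      rw [h1, integral_indicator measurableSet_Ioi, Measure.restrict_restrict measurableSet_Ioi]
      congr 2
      ext x; simp
  · intro δ hδ
    obtain ⟨C, hC0, hC⟩ := hB (δ / 2) (by linarith)
    refine ⟨∫ x in Ioi (1:ℝ), C * x ^ (-δ / 2 - 1), fun s hs => ?_⟩
    beta_reduce
    rw [hE]
    refine norm_integral_le_of_norm_le ?_ ?_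
    · exact (integrableOn_Ioi_rpow_of_lt (by linarith) (by norm_num)).const_mul C
    · filter_upwards [ae_restrict_mem measurableSet_Ioi] with x hx
      have hx1 : (1:ℝ) < x := hx
      have hx0 : (0:ℝ) < x := by linarith
      rw [norm_mul, Complex.norm_real, Complex.norm_cpow_eq_rpow_re_of_pos hx0, Real.norm_eq_abs]
      calc _ ≤ (C * x ^ (γ + δ / 2)) * x ^ ((-s - 1).re) := by
            gcongr; exact hC x hx1.le
        _ = C * x ^ (γ + δ / 2 + (-s - 1).re) := by
            rw [mul_assoc, ← Real.rpow_add hx0]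
        _ ≤ _ := by
            gcongr
            · exact hx1.le
            · simp; linarith
  · intro s hs
    beta_reduce
    rw [hE]
    have hs0 : s ≠ 0 := by rintro rfl; norm_num at hs
    have hs1 : s - 1 ≠ 0 := by
      intro h; rw [sub_eq_zero.1 h] at hs; norm_num at hs
    have hσ0 : 0 < s.re := by linarith
    have h1 : ∫ x in Ioi (1:ℝ), (A x : ℂ) * (x : ℂ) ^ (-s - 1) =
        ρ / (s - 1) + ∫ x in Ioi (1:ℝ), ((A x - ρ * x : ℝ) : ℂ) * (x : ℂ) ^ (-s - 1) := by
      rw [setIntegral_congr_fun measurableSet_Ioi (hsplit s),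
        integral_add (hIlin s hs) (hIE s (by linarith)), integral_const_mul,
        integral_Ioi_cpow_of_lt (by simpa using hs) (by norm_num)]
      congr 1
      rw [Complex.ofReal_one, Complex.one_cpow, show -s + 1 = -(s - 1) by ring, neg_div_neg_eq]
      ring
    have h2 := hasSum_integral_of_summable_integral_norm (μ := volume.restrict (Ioi (1:ℝ)))
      (F := fun j (x : ℝ) => (w j : ℂ) * (if n j ≤ x then (x:ℂ) ^ (-s - 1) else 0))
      (fun j => ((int_cpx (n j) s (hn j) hσ0).1).const_mul _) ?_
    · have h3 : ∫ x in Ioi (1:ℝ), (∑' j, (w j : ℂ) * (if n j ≤ x then (x:ℂ) ^ (-s - 1) else 0)) =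
          ∫ x in Ioi (1:ℝ), (A x : ℂ) * (x : ℂ) ^ (-s - 1) := by
        refine setIntegral_congr_fun measurableSet_Ioi fun x hx => ?_
        have := (Complex.hasSum_ofReal.2 (hA x)).mul_right ((x : ℂ) ^ (-s - 1))
        rw [← this.tsum_eq]
        refine tsum_congr fun j => ?_
        split_ifs <;> simp
      rw [h3, h1] at h2
      have h4 := h2.mul_left s
      rw [show (ρ:ℂ) * s / (s - 1) + s * (∫ x in Ioi (1:ℝ), ((A x - ρ * x : ℝ) : ℂ) *
        (x : ℂ) ^ (-s - 1)) = s * (ρ / (s - 1) + ∫ x in Ioi (1:ℝ), ((A x - ρ * x : ℝ) : ℂ) *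
        (x : ℂ) ^ (-s - 1)) by ring]
      have h5 : ∀ j, (w j : ℂ) * (n j : ℂ) ^ (-s) = s * ∫ (a : ℝ) in Ioi 1,
          (w j : ℂ) * (if n j ≤ a then (a:ℂ) ^ (-s - 1) else 0) := fun j => by
        rw [integral_const_mul, (int_cpx (n j) s (hn j) hσ0).2]
        field_simp
      simp only [h5]
      exact h4
    · refine ((hsum s.re hs).div_const s.re).congr fun j => ?_
      rw [mul_div_assoc, ← (int_real (n j) s.re (hn j) hσ0).2, ← integral_const_mul]
      refine (setIntegral_congr_fun measurableSet_Ioi fun x hx => ?_)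
      have hx0 : (0:ℝ) < x := lt_trans one_pos hx
      simp only [norm_mul, Complex.norm_real, Real.norm_eq_abs, abs_of_nonneg (hw j)]
      split_ifs
      · rw [Complex.norm_cpow_eq_rpow_re_of_pos hx0]; simp
      · simp

/-- the generalized integer attached to `e` -/
noncomputable def nn (p : ℕ → ℝ) (e : ℕ →₀ ℕ) : ℝ := ∏ i ∈ e.support, p i ^ e i

lemma nn_ge (p : ℕ → ℝ) (hp : ∀ i, 1 < p i) (e : ℕ →₀ ℕ) : 1 ≤ nn p e := by
  unfold nn
  have : ∀ s : Finset ℕ, 1 ≤ ∏ i ∈ s, p i ^ e i := by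
    intro s
    induction s using Finset.induction_on with
    | empty => simp
    | insert a s ha ih =>
      rw [Finset.prod_insert ha]
      exact one_le_mul_of_one_le_of_one_le (one_le_pow₀ (hp a).le) ih
  exact this _

lemma nn_add (p : ℕ → ℝ) (e f : ℕ →₀ ℕ) : nn p (e + f) = nn p e * nn p f := by
  have := Finsupp.prod_add_index' (f := e) (g := f) (h := fun i k => p i ^ k) (by simp)
    (fun i a b => pow_add _ _ _)
  simpa [Finsupp.prod, nn] using this

lemma nn_single (p : ℕ → ℝ) (i k : ℕ) : nn p (Finsupp.single i k) = p i ^ k := by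
  have := Finsupp.prod_single_index (a := i) (b := k) (h := fun i k => p i ^ k) (by simp)
  simpa [Finsupp.prod, nn] using this

lemma nn_zero (p : ℕ → ℝ) : nn p 0 = 1 := by simp [nn]

lemma nn_ge_pow (p : ℕ → ℝ) (hp : ∀ i, 1 < p i) (e : ℕ →₀ ℕ) (i : ℕ) : p i ^ e i ≤ nn p e := by
  conv_rhs => rw [← Finsupp.single_add_erase i e, nn_add, nn_single]
  have h1 := nn_ge p hp (e.erase i)
  have : 0 < p i ^ e i := pow_pos (by linarith [hp i]) _
  nlinarith

lemma nn_log (p : ℕ → ℝ) (hp : ∀ i, 1 < p i) (e : ℕ →₀ ℕ) :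
    Real.log (nn p e) = ∑ i ∈ e.support, (e i : ℝ) * Real.log (p i) := by
  unfold nn
  rw [Real.log_prod fun i _ => (pow_pos (by linarith [hp i]) _).ne']
  simp [Real.log_pow]

lemma exists_bd (p : ℕ → ℝ) (hmono : Monotone p) (hp0 : 1 < p 0)
    (htop : Tendsto p atTop atTop) (x : ℝ) :
    ∃ I K : ℕ, ∀ i k, p i ^ k ≤ x → k < K ∧ (k ≠ 0 → i < I) := by
  obtain ⟨I, hI⟩ := (htop.eventually_gt_atTop x).exists
  obtain ⟨K, hK⟩ := pow_unbounded_of_one_lt x hp0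
  refine ⟨I, K, fun i k h => ⟨?_, fun hk => ?_⟩⟩
  · by_contra hk
    push Not at hk
    have h1 : p 0 ^ K ≤ p 0 ^ k := pow_le_pow_right₀ hp0.le hk
    have h2 : p 0 ^ k ≤ p i ^ k := pow_le_pow_left₀ (by linarith) (hmono (Nat.zero_le i)) k
    linarith
  · by_contra hi
    push Not at hi
    have h0 : 1 < p i := hp0.trans_le (hmono (Nat.zero_le i))
    have h1 : p I ≤ p i := hmono hi
    have h2 : p i ≤ p i ^ k := le_self_pow₀ h0.le hk
    linarith

lemma hasSum_NP (p : ℕ → ℝ) (hmono : Monotone p) (hp0 : 1 < p 0)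
    (htop : Tendsto p atTop atTop) (x : ℝ) :
    HasSum (fun e => if nn p e ≤ x then (1:ℝ) else 0) (NP p x) := by
  have hp : ∀ i, 1 < p i := fun i => hp0.trans_le (hmono (Nat.zero_le i))
  obtain ⟨I, K, h⟩ := exists_bd p hmono hp0 htop x
  have hfin : {e : ℕ →₀ ℕ | ∏ i ∈ e.support, p i ^ e i ≤ x}.Finite := by
    refine ((Finset.range I).finsupp (fun _ => Finset.range K)).finite_toSet.subset ?_
    intro e he
    have he' : ∀ i, p i ^ e i ≤ x := fun i => (nn_ge_pow p hp e i).trans he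
    rw [Finset.mem_coe, Finset.mem_finsupp_iff]
    refine ⟨fun i hi => ?_, fun i _ => ?_⟩
    · exact Finset.mem_range.2 ((h i _ (he' i)).2 (Finsupp.mem_support_iff.1 hi))
    · exact Finset.mem_range.2 (h i _ (he' i)).1
  have h1 := hasSum_sum_of_ne_finset_zero (L := SummationFilter.unconditional _) (f := fun e => if nn p e ≤ x then (1:ℝ) else 0)
    (s := hfin.toFinset) (fun e he => by
      rw [Set.Finite.mem_toFinset] at he
      exact if_neg he)
  convert h1 using 1
  rw [NP, Nat.card_eq_card_finite_toFinset hfin, Finset.card_eq_sum_ones]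
  push_cast
  refine Finset.sum_congr rfl fun e he => ?_
  rw [Set.Finite.mem_toFinset] at he
  exact (if_pos he).symm

lemma hasSum_psiP (p : ℕ → ℝ) (hmono : Monotone p) (hp0 : 1 < p 0)
    (htop : Tendsto p atTop atTop) (x : ℝ) :
    HasSum (fun ik : ℕ × ℕ => if p ik.1 ^ (ik.2 + 1) ≤ x then Real.log (p ik.1) else 0)
      (psiP p x) := by
  obtain ⟨I, K, h⟩ := exists_bd p hmono hp0 htop x
  have hfin : {ik : ℕ × ℕ | 1 ≤ ik.2 ∧ p ik.1 ^ ik.2 ≤ x}.Finite := by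
    refine (Finset.range I ×ˢ Finset.range K).finite_toSet.subset ?_
    rintro ⟨i, k⟩ ⟨hk, hx⟩
    simp only [Finset.coe_product, Set.mem_prod, Finset.mem_coe, Finset.mem_range]
    exact ⟨(h i k hx).2 (by simp at hk; omega), (h i k hx).1⟩
  have hfin2 : {ik : ℕ × ℕ | p ik.1 ^ (ik.2 + 1) ≤ x}.Finite := by
    refine (Finset.range I ×ˢ Finset.range K).finite_toSet.subset ?_
    rintro ⟨i, k⟩ hx
    simp only [Finset.coe_product, Set.mem_prod, Finset.mem_coe, Finset.mem_range]
    have := h i (k + 1) hx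
    exact ⟨this.2 (by omega), by omega⟩
  have h1 := hasSum_sum_of_ne_finset_zero (L := SummationFilter.unconditional _)
    (f := fun ik : ℕ × ℕ => if p ik.1 ^ (ik.2 + 1) ≤ x then Real.log (p ik.1) else 0)
    (s := hfin2.toFinset) (fun e he => by
      rw [Set.Finite.mem_toFinset] at he
      exact if_neg he)
  convert h1 using 1
  rw [psiP, finsum_mem_eq_finite_toFinset_sum _ hfin]
  refine Finset.sum_bij (fun ik _ => (ik.1, ik.2 - 1)) ?_ ?_ ?_ ?_
  · rintro ⟨i, k⟩ hik
    simp only [Set.Finite.mem_toFinset, Set.mem_ofPred_eq] at hik ⊢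
    rw [Nat.sub_add_cancel hik.1]; exact hik.2
  · rintro ⟨i, k⟩ hik ⟨i', k'⟩ hik' heq
    simp only [Set.Finite.mem_toFinset, Set.mem_ofPred_eq] at hik hik'
    simp only [Prod.mk.injEq] at heq ⊢
    omega
  · rintro ⟨i, k⟩ hik
    simp only [Set.Finite.mem_toFinset, Set.mem_ofPred_eq] at hik
    exact ⟨(i, k + 1), by simp [hik], by simp⟩
  · rintro ⟨i, k⟩ hik
    simp only [Set.Finite.mem_toFinset, Set.mem_ofPred_eq] at hik ⊢
    rw [Nat.sub_add_cancel hik.1, if_pos hik.2]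

/-- shifting bijection -/
noncomputable def shiftEquiv : ((ℕ →₀ ℕ) × (ℕ × ℕ)) ≃
    {x : (ℕ →₀ ℕ) × (ℕ × ℕ) // x.2.2 < x.1 x.2.1} where
  toFun x := ⟨(x.1 + Finsupp.single x.2.1 (x.2.2 + 1), x.2), by simp; omega⟩
  invFun x := (x.1.1 - Finsupp.single x.1.2.1 (x.1.2.2 + 1), x.1.2)
  left_inv x := by
    obtain ⟨e, i, k⟩ := x
    simp
  right_inv x := by
    obtain ⟨⟨e, i, k⟩, h⟩ := x
    simp only at h
    apply Subtype.ext
    simp only [Prod.mk.injEq, and_true]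
    apply tsub_add_cancel_of_le
    rw [Finsupp.single_le_iff]
    omega

lemma hasSum_mul_gen {a b : Type*} (f : a → ℂ) (g : b → ℂ) (z q : ℂ)
    (hf : Summable fun x => ‖f x‖) (hg : Summable fun x => ‖g x‖)
    (hz : HasSum f z) (hq : HasSum g q) :
    HasSum (fun x : a × b => f x.1 * g x.2) (z * q) := by
  have h0 := summable_mul_of_summable_norm hf hg
  exact hz.mul hq h0

lemma conv_sum (p : ℕ → ℝ) (hp : ∀ i, 1 < p i) (s : ℂ)
    (hZ : Summable fun e => ‖(nn p e : ℂ) ^ (-s)‖)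
    (hP : Summable fun ik : ℕ × ℕ => ‖(Real.log (p ik.1) : ℂ) * ((p ik.1 ^ (ik.2 + 1) : ℝ) : ℂ) ^ (-s)‖)
    (z q : ℂ) (hz : HasSum (fun e => (nn p e : ℂ) ^ (-s)) z)
    (hq : HasSum (fun ik : ℕ × ℕ =>
      (Real.log (p ik.1) : ℂ) * ((p ik.1 ^ (ik.2 + 1) : ℝ) : ℂ) ^ (-s)) q) :
    HasSum (fun e => (Real.log (nn p e) : ℂ) * (nn p e : ℂ) ^ (-s)) (z * q) := by
  have h1 : HasSum (fun x : (ℕ →₀ ℕ) × (ℕ × ℕ) => (nn p x.1 : ℂ) ^ (-s) *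
      ((Real.log (p x.2.1) : ℂ) * ((p x.2.1 ^ (x.2.2 + 1) : ℝ) : ℂ) ^ (-s))) (z * q) :=
    hasSum_mul_gen (fun e => (nn p e : ℂ) ^ (-s)) (fun ik : ℕ × ℕ =>
      (Real.log (p ik.1) : ℂ) * ((p ik.1 ^ (ik.2 + 1) : ℝ) : ℂ) ^ (-s)) z q hZ hP hz hq
  set F : (ℕ →₀ ℕ) × (ℕ × ℕ) → ℂ := fun x => (Real.log (p x.2.1) : ℂ) * (nn p x.1 : ℂ) ^ (-s)
  have h2 : HasSum (fun x : {x : (ℕ →₀ ℕ) × (ℕ × ℕ) // x.2.2 < x.1 x.2.1} => F x.1) (z * q) := by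
    rw [← shiftEquiv.hasSum_iff]
    convert h1 using 1
    ext x
    simp only [Function.comp, F, shiftEquiv, Equiv.coe_fn_mk]
    rw [nn_add, nn_single, Complex.ofReal_mul, Complex.mul_cpow_ofReal_nonneg]
    · ring
    · linarith [nn_ge p hp x.1]
    · exact pow_nonneg (by linarith [hp x.2.1]) _
  have h3 : HasSum ({x : (ℕ →₀ ℕ) × (ℕ × ℕ) | x.2.2 < x.1 x.2.1}.indicator F) (z * q) :=
    hasSum_subtype_iff_indicator.1 h2
  refine h3.prod_fiberwise fun e => ?_
  have h4 : (Real.log (nn p e) : ℂ) * (nn p e : ℂ) ^ (-s) =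
      ∑ ik ∈ e.support.biUnion (fun i => (Finset.range (e i)).image (fun k => (i, k))),
        {x : (ℕ →₀ ℕ) × (ℕ × ℕ) | x.2.2 < x.1 x.2.1}.indicator F (e, ik) := by
    rw [Finset.sum_biUnion, nn_log p hp, Complex.ofReal_sum, Finset.sum_mul]
    · refine Finset.sum_congr rfl fun i _ => ?_
      rw [Finset.sum_image (by intro a _ b _ h; simpa using h)]
      rw [Finset.sum_congr rfl (g := fun _ => (Real.log (p i) : ℂ) * (nn p e : ℂ) ^ (-s))]
      · simp; ring
      · intro k hk
        rw [Set.indicator_of_mem]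
        simpa using hk
    · intro i _ j _ hij
      simp only [Function.onFun]
      rw [Finset.disjoint_left]
      rintro ⟨a, b⟩ h1 h2
      simp at h1 h2
      exact hij (h1.2.trans h2.2.symm)
  rw [h4]
  apply hasSum_sum_of_ne_finset_zero
  rintro ⟨i, k⟩ hik
  apply Set.indicator_of_notMem
  simp only [Set.mem_ofPred_eq]
  intro hlt
  apply hik
  simp
  exact ⟨by omega, hlt⟩

lemma ode_extend (Θ : ℝ) (hΘ1 : Θ < 1) (W J : ℂ → ℂ) (hW : DifferentiableOn ℂ W {s | Θ < s.re})
    (hJ : DifferentiableOn ℂ J {s | Θ < s.re})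
    (hode : ∀ s : ℂ, 1 < s.re → deriv W s = -(J s * W s)) :
    ∀ s : ℂ, Θ < s.re → deriv W s = -(J s * W s) := by
  have hU : IsOpen {s : ℂ | Θ < s.re} := isOpen_lt continuous_const Complex.continuous_re
  have hU1 : IsOpen {s : ℂ | 1 < s.re} := isOpen_lt continuous_const Complex.continuous_re
  have h1 : AnalyticOnNhd ℂ (deriv W) {s | Θ < s.re} := (hW.deriv hU).analyticOnNhd hU
  have h2 : AnalyticOnNhd ℂ (fun s => -(J s * W s)) {s | Θ < s.re} :=
    ((hJ.mul hW).neg).analyticOnNhd hU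
  have hc : IsPreconnected {s : ℂ | Θ < s.re} := (convex_halfSpace_re_gt Θ).isPreconnected
  have := h1.eqOn_of_preconnected_of_eventuallyEq h2 hc (z₀ := 2) (by simp; linarith) (by
    filter_upwards [hU1.mem_nhds (show (2:ℂ) ∈ {s : ℂ | 1 < s.re} by simp)] with s hs
    exact hode s hs)
  exact fun s hs => this hs

lemma horiz (Θ : ℝ) (W J : ℂ → ℂ) (hW : DifferentiableOn ℂ W {s | Θ < s.re})
    (hode : ∀ s : ℂ, Θ < s.re → deriv W s = -(J s * W s)) (t x y K : ℝ) (hx : Θ < x) (hy : Θ < y)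
    (hK : ∀ u ∈ Set.uIcc x y, ‖J (u + t * Complex.I)‖ ≤ K) :
    ‖W (x + t * Complex.I)‖ ≤ ‖W (y + t * Complex.I)‖ * Real.exp (K * |x - y|) := by
  have hU : IsOpen {s : ℂ | Θ < s.re} := isOpen_lt continuous_const Complex.continuous_re
  set γ : ℝ → ℂ := fun r => ((y + r * (x - y) : ℝ) : ℂ) + t * Complex.I
  have hmem : ∀ r ∈ Set.Icc (0:ℝ) 1, y + r * (x - y) ∈ Set.uIcc x y := by
    intro r hr
    rw [Set.mem_uIcc]
    rcases le_total x y with h | h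
    · left; constructor <;> nlinarith [hr.1, hr.2]
    · right; constructor <;> nlinarith [hr.1, hr.2]
  have hre : ∀ r ∈ Set.Icc (0:ℝ) 1, Θ < (γ r).re := by
    intro r hr
    have := hmem r hr
    rw [Set.mem_uIcc] at this
    have h2 : (γ r).re = y + r * (x - y) := by simp [γ]
    rw [h2]
    rcases this with h | h <;> linarith [h.1]
  have hγ : ∀ r, HasDerivAt γ ((x - y : ℝ) : ℂ) r := by
    intro r
    have h1 : HasDerivAt (fun r : ℝ => y + r * (x - y)) (x - y) r := by
      simpa using ((hasDerivAt_id r).mul_const (x - y)).const_add y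
    exact h1.ofReal_comp.add_const _
  have hd : ∀ r ∈ Set.Icc (0:ℝ) 1,
      HasDerivAt (fun r => W (γ r)) (-(J (γ r) * W (γ r)) * ((x - y : ℝ) : ℂ)) r := by
    intro r hr
    have h1 : HasDerivAt W (deriv W (γ r)) (γ r) :=
      (hW.differentiableAt (hU.mem_nhds (hre r hr))).hasDerivAt
    rw [hode _ (hre r hr)] at h1
    exact h1.comp r (hγ r)
  have := norm_le_gronwallBound_of_norm_deriv_right_le (f := fun r => W (γ r))
    (f' := fun r => -(J (γ r) * W (γ r)) * ((x - y : ℝ) : ℂ)) (δ := ‖W (γ 0)‖) (K := K * |x - y|)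
    (ε := 0) (a := 0) (b := 1) (fun r hr => (hd r hr).continuousAt.continuousWithinAt)
    (fun r hr => (hd r ⟨hr.1, hr.2.le⟩).hasDerivWithinAt) le_rfl (by
      intro r hr
      have h1 := hK _ (hmem r ⟨hr.1, hr.2.le⟩)
      rw [norm_mul, norm_neg, norm_mul, Complex.norm_real, Real.norm_eq_abs, add_zero]
      calc _ ≤ K * ‖W (γ r)‖ * |x - y| := by gcongr
        _ = _ := by ring) 1 (by simp)
  rw [gronwallBound_ε0] at this
  simpa [γ] using this

lemma one_le_Lam (t : ℝ) : 1 ≤ Real.log (|t| + 3) := by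
  rw [Real.le_log_iff_exp_le (by positivity)]
  linarith [Real.exp_one_lt_d9, abs_nonneg t]

open Metric in
lemma log_bound (Θ : ℝ) (hΘ0 : 0 ≤ Θ) (W J : ℂ → ℂ)
    (hW : DifferentiableOn ℂ W {s | Θ < s.re})
    (hJ : DifferentiableOn ℂ J {s | Θ < s.re})
    (hode : ∀ s : ℂ, Θ < s.re → deriv W s = -(J s * W s))
    (hWb : ∀ δ > 0, ∃ C, ∀ s : ℂ, Θ + δ ≤ s.re → ‖W s‖ ≤ C * (1 + ‖s‖) ^ 2)
    (hJb : ∀ b > 1, ∃ K, ∀ s : ℂ, b ≤ s.re → ‖J s‖ ≤ K)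
    (σ₁ : ℝ) (hσ₁ : 2 ≤ σ₁) (hlow : ∀ s : ℂ, σ₁ ≤ s.re → ‖s - 1‖ ≤ 2 * ‖W s‖) (δ : ℝ) (hδ : 0 < δ) :
    ∃ C, ∀ σ t : ℝ, Θ + δ ≤ σ → ‖J (σ + t * Complex.I)‖ ≤ C * Real.log (|t| + 3) := by
  obtain ⟨K, hK⟩ := hJb σ₁ (by linarith)
  obtain ⟨C0, hC0⟩ := hWb (δ / 3) (by linarith)
  set C := max C0 1
  have hC1 : 1 ≤ C := le_max_right _ _
  have hC : ∀ s : ℂ, Θ + δ / 3 ≤ s.re → ‖W s‖ ≤ C * (1 + ‖s‖) ^ 2 := fun s hs =>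
    (hC0 s hs).trans (by gcongr; exact le_max_left _ _)
  set B := 2 * C * (2 * σ₁ + 1) ^ 2
  have hB1 : 1 ≤ B := by
    have : 1 ≤ (2 * σ₁ + 1) ^ 2 := one_le_pow₀ (by linarith)
    nlinarith
  have hlB : 0 ≤ Real.log B := Real.log_nonneg hB1
  set M0 := Real.log B + 2
  refine ⟨max K (2 * M0 * σ₁ / (δ / 3) / (δ / 3)), fun σ t hσ => ?_⟩
  have hΛ := one_le_Lam t
  set Λ := Real.log (|t| + 3)
  rcases le_or_gt σ₁ σ with h | h
  · have := hK (σ + t * Complex.I) (by simpa using h)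
    have hK0 : 0 ≤ K := (norm_nonneg _).trans this
    have h2 : K ≤ max K (2 * M0 * σ₁ / (δ / 3) / (δ / 3)) := le_max_left _ _
    nlinarith
  have hU : IsOpen {s : ℂ | Θ < s.re} := isOpen_lt continuous_const Complex.continuous_re
  set c : ℂ := σ₁ + t * Complex.I
  have hcre : c.re = σ₁ := by simp [c]
  have hball : ∀ z : ℂ, ∀ r : ℝ, z ∈ ball c r → σ₁ - r < z.re := by
    intro z r hz
    rw [mem_ball, dist_eq_norm] at hz
    have h1 := (Complex.abs_re_le_norm (z - c)).trans_lt hz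
    rw [Complex.sub_re, hcre, abs_lt] at h1
    linarith [h1.1]
  have hsub : ball c (σ₁ - Θ) ⊆ {s : ℂ | Θ < s.re} := by
    intro z hz
    have := hball z _ hz
    simp only [Set.mem_ofPred_eq]
    linarith
  obtain ⟨f, hf⟩ := (hJ.neg.mono hsub).isExactOn_ball
  have hcm : c ∈ ball c (σ₁ - Θ) := mem_ball_self (by linarith)
  -- exponential formula
  have hWexp : ∀ z ∈ ball c (σ₁ - Θ), W z = W c * Complex.exp (f z - f c) := by
    intro z hz
    have hder : ∀ x ∈ ball c (σ₁ - Θ), HasDerivAt (fun x => W x * Complex.exp (-f x)) 0 x := by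
      intro x hx
      have h1 : HasDerivAt W (deriv W x) x :=
        (hW.differentiableAt (hU.mem_nhds (hsub hx))).hasDerivAt
      rw [hode _ (hsub hx)] at h1
      have h2 := h1.mul ((hf x hx).neg.cexp)
      refine h2.congr_deriv ?_
      simp
      ring
    have := isOpen_ball.is_const_of_deriv_eq_zero (convex_ball c (σ₁ - Θ)).isPreconnected
      (fun x hx => (hder x hx).differentiableAt.differentiableWithinAt)
      (fun x hx => (hder x hx).deriv) hz hcm
    rw [Complex.exp_neg, Complex.exp_neg] at this
    rw [Complex.exp_sub]
    have e1 := Complex.exp_ne_zero (f z)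
    have e2 := Complex.exp_ne_zero (f c)
    field_simp at this ⊢
    exact this
  have hWc : 1 / 2 ≤ ‖W c‖ := by
    have h1 := hlow c hcre.ge
    have h2 : 1 ≤ ‖c - 1‖ := by
      refine le_trans ?_ (Complex.re_le_norm (c - 1))
      simp [c]; linarith
    linarith
  set R := σ₁ - Θ - δ / 3
  have hR : 0 < R := by simp only [R]; linarith
  set g : ℂ → ℂ := fun w => f (c + w) - f c
  have hmem : ∀ w ∈ ball (0:ℂ) R, c + w ∈ ball c (σ₁ - Θ) := by
    intro w hw
    rw [mem_ball_zero_iff] at hw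
    rw [mem_ball, dist_eq_norm, add_sub_cancel_left]
    simp only [R] at hw
    linarith
  have hgd : ∀ w ∈ ball (0:ℂ) R, HasDerivAt g (-J (c + w)) w := by
    intro w hw
    exact ((hf _ (hmem w hw)).comp_const_add c w).sub_const _
  have hMpos : 0 < M0 * Λ := by positivity
  have hre : Set.MapsTo g (ball 0 R) {z | z.re ≤ M0 * Λ} := by
    intro w hw
    have h1 := hWexp _ (hmem w hw)
    have h2 : ‖W (c + w)‖ = ‖W c‖ * Real.exp (g w).re := by
      rw [h1, norm_mul, Complex.norm_exp]
    have hw' := mem_ball_zero_iff.1 hw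
    have h3 : ‖W (c + w)‖ ≤ C * ((2 * σ₁ + 1) * (|t| + 3)) ^ 2 := by
      refine (hC _ ?_).trans ?_
      · have := hball (c + w) R (by rwa [mem_ball, dist_eq_norm, add_sub_cancel_left])
        simp only [R] at this
        linarith
      · gcongr
        have h4 : ‖c‖ ≤ σ₁ + |t| := by
          refine (norm_add_le _ _).trans ?_
          simp [abs_of_pos (by linarith : 0 < σ₁)]
        have h5 := norm_add_le c w
        simp only [R] at hw'
        nlinarith [abs_nonneg t]
    have h6 : Real.exp (g w).re ≤ B * (|t| + 3) ^ 2 := by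
      have h7 : 1 / 2 * Real.exp (g w).re ≤ ‖W c‖ * Real.exp (g w).re := by gcongr
      have h8 : C * ((2 * σ₁ + 1) * (|t| + 3)) ^ 2 = B * (|t| + 3) ^ 2 / 2 := by
        simp only [B]; ring
      linarith
    have h9 := Real.log_le_log (Real.exp_pos _) h6
    rw [Real.log_exp, Real.log_mul (by positivity) (by positivity), Real.log_pow] at h9
    simp only [Set.mem_ofPred_eq, M0]
    push_cast at h9
    change _ ≤ _ + 2 * Λ at h9
    nlinarith
  have hgb : ∀ w : ℂ, ‖w‖ ≤ R - δ / 3 → ‖g w‖ ≤ 2 * (M0 * Λ) * σ₁ / (δ / 3) := by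
    intro w hw
    have := Complex.borelCaratheodory_zero hMpos
      (fun w hw => (hgd w hw).differentiableAt.differentiableWithinAt) hre hR
      (z := w) (mem_ball_zero_iff.2 (by linarith)) (by simp [g])
    refine this.trans ?_
    gcongr
    · simp only [R] at hw; linarith
    · linarith
  set w0 : ℂ := ((σ - σ₁ : ℝ) : ℂ)
  have hw0 : ‖w0‖ = σ₁ - σ := by
    rw [Complex.norm_real, Real.norm_eq_abs, abs_of_neg (by linarith)]; ring
  have hclb : ∀ w ∈ closedBall w0 (δ / 3), ‖w‖ ≤ R - δ / 3 := by
    intro w hw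
    rw [mem_closedBall, dist_eq_norm] at hw
    have : ‖w‖ ≤ ‖w - w0‖ + ‖w0‖ := norm_le_norm_sub_add w w0
    simp only [R]
    linarith
  have hcau := Complex.norm_deriv_le_of_forall_mem_sphere_norm_le (f := g) (c := w0) (R := δ / 3)
    (C := 2 * (M0 * Λ) * σ₁ / (δ / 3)) (by linarith) (by
      apply DifferentiableOn.diffContOnCl
      intro w hw
      rw [closure_ball _ (by linarith)] at hw
      exact (hgd w (mem_ball_zero_iff.2
        (by linarith [hclb w hw]))).differentiableAt.differentiableWithinAt)
    (fun z hz => hgb z (hclb z (sphere_subset_closedBall hz)))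
  rw [(hgd w0 (mem_ball_zero_iff.2 (by rw [hw0]; simp only [R]; linarith))).deriv, norm_neg] at hcau
  have hcw : c + w0 = σ + t * Complex.I := by
    simp only [c, w0]; push_cast; ring
  rw [hcw] at hcau
  refine hcau.trans ?_
  calc _ = (2 * M0 * σ₁ / (δ / 3) / (δ / 3)) * Λ := by ring
    _ ≤ _ := by gcongr; exact le_max_right _ _

open Complex.HadamardThreeLines in
lemma interp_bound (Θ : ℝ) (hΘ1 : Θ < 1) (J : ℂ → ℂ)
    (hJ : DifferentiableOn ℂ J {s | Θ < s.re})
    (hJb : ∀ b > 1, ∃ K, ∀ s : ℂ, b ≤ s.re → ‖J s‖ ≤ K)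
    (hlog : ∀ δ > 0, ∃ C, ∀ σ t : ℝ, Θ + δ ≤ σ →
      ‖J (σ + t * Complex.I)‖ ≤ C * Real.log (|t| + 3)) (η : ℝ) (hη : 0 < η) :
    ∃ C, 0 ≤ C ∧ ∀ σ t : ℝ, Θ + η ≤ σ → σ ≤ 1 + η →
      ‖J (σ + t * Complex.I)‖ ≤ C * Real.log (|t| + 3) ^ ((1 + η - σ) / (1 - Θ)) := by
  obtain ⟨K, hK⟩ := hJb (1 + η) (by linarith)
  obtain ⟨C, hC⟩ := hlog η hη
  set D := max (max K C) 1
  have hDK : K ≤ D := (le_max_left _ _).trans (le_max_left _ _)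
  have hDC : C ≤ D := (le_max_right _ _).trans (le_max_left _ _)
  have hD1 : 1 ≤ D := le_max_right _ _
  set B := D * Real.exp ((1 - Θ) ^ 2)
  have hB : 0 < B := by positivity
  refine ⟨2 * B, by positivity, fun σ₀ t₀ h1 h2 => ?_⟩
  have hΛ := one_le_Lam t₀
  set Λ := Real.log (|t₀| + 3) with hΛdef
  set s₀ : ℂ := σ₀ + t₀ * Complex.I
  have hs₀re : s₀.re = σ₀ := by simp [s₀]
  have hs₀im : s₀.im = t₀ := by simp [s₀]
  set G : ℂ → ℂ := fun s => J s * Complex.exp ((s - s₀) ^ 2)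
  have hexp : ∀ z : ℂ, Θ + η ≤ z.re → z.re ≤ 1 + η → ‖Complex.exp ((z - s₀) ^ 2)‖ ≤
      Real.exp ((1 - Θ) ^ 2) * Real.exp (-(z.im - t₀) ^ 2) := by
    intro z hz1 hz2
    rw [Complex.norm_exp, ← Real.exp_add]
    apply Real.exp_le_exp.2
    have : ((z - s₀) ^ 2).re = (z.re - σ₀) ^ 2 - (z.im - t₀) ^ 2 := by
      rw [pow_two, Complex.mul_re, Complex.sub_re, Complex.sub_im, hs₀re, hs₀im]; ring
    rw [this]
    have : (z.re - σ₀) ^ 2 ≤ (1 - Θ) ^ 2 := by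
      apply sq_le_sq'
      · linarith
      · linarith
    linarith
  have hstrip : ∀ z : ℂ, Θ + η ≤ z.re → z.re ≤ 1 + η → ‖G z‖ ≤ 2 * B * Λ := by
    intro z hz1 hz2
    have hz : z = (z.re : ℂ) + z.im * Complex.I := (Complex.re_add_im z).symm
    have hJz : ‖J z‖ ≤ D * Real.log (|z.im| + 3) := by
      have := hC z.re z.im hz1
      rw [← hz] at this
      exact this.trans (by have := one_le_Lam z.im; gcongr)
    set u := z.im - t₀
    have hl : Real.log (|z.im| + 3) ≤ Λ + |u| := by
      have h3 : |z.im| + 3 ≤ (|t₀| + 3) * (1 + |u|) := by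
        have : |z.im| ≤ |u| + |t₀| := by
          have := abs_add_le u t₀
          simpa [u] using this
        nlinarith [abs_nonneg u, abs_nonneg t₀]
      have h4 := Real.log_le_log (by positivity) h3
      rw [Real.log_mul (by positivity) (by positivity)] at h4
      have h5 := Real.log_le_sub_one_of_pos (show 0 < 1 + |u| by positivity)
      linarith
    have hue : (Λ + |u|) * Real.exp (-u ^ 2) ≤ 2 * Λ := by
      have h3 : Real.exp (-u ^ 2) ≤ 1 := Real.exp_le_one_iff.2 (by nlinarith [sq_nonneg u])
      have h4 : |u| * Real.exp (-u ^ 2) ≤ 1 := by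
        rw [Real.exp_neg, ← div_eq_mul_inv, div_le_one (Real.exp_pos _)]
        have h5 := Real.add_one_le_exp (u ^ 2)
        have h6 : |u| ≤ u ^ 2 + 1 := by
          rw [← sq_abs]; nlinarith [sq_nonneg (|u| - 1)]
        linarith
      nlinarith
    calc ‖G z‖ = ‖J z‖ * ‖Complex.exp ((z - s₀) ^ 2)‖ := norm_mul _ _
      _ ≤ (D * (Λ + |u|)) * (Real.exp ((1 - Θ) ^ 2) * Real.exp (-u ^ 2)) := by
          gcongr
          · exact hJz.trans (by gcongr)
          · exact hexp z hz1 hz2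
      _ = B * ((Λ + |u|) * Real.exp (-u ^ 2)) := by simp only [B]; ring
      _ ≤ B * (2 * Λ) := by gcongr
      _ = _ := by ring
  have hright : ∀ z : ℂ, z.re = 1 + η → ‖G z‖ ≤ 2 * B := by
    intro z hz
    have h3 : ‖J z‖ ≤ D := (hK z hz.ge).trans hDK
    calc ‖G z‖ = ‖J z‖ * ‖Complex.exp ((z - s₀) ^ 2)‖ := norm_mul _ _
      _ ≤ D * (Real.exp ((1 - Θ) ^ 2) * 1) := by
          gcongr
          refine (hexp z (by linarith) hz.le).trans ?_
          gcongr
          exact Real.exp_le_one_iff.2 (by nlinarith [sq_nonneg (z.im - t₀)])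
      _ ≤ _ := by simp only [B]; nlinarith
  have hdiff : DifferentiableOn ℂ G {s | Θ < s.re} :=
    hJ.mul (by fun_prop)
  have hmain := norm_le_interp_of_mem_verticalClosedStrip' (f := G) (z := s₀) (l := Θ + η)
    (u := 1 + η) (a := 2 * B * Λ) (b := 2 * B) (by linarith)
    (by simp [verticalClosedStrip, hs₀re, h1, h2])
    (by
      apply DifferentiableOn.diffContOnCl
      refine hdiff.mono ?_
      have : closure (verticalStrip (Θ + η) (1 + η)) ⊆ {s : ℂ | Θ + η ≤ s.re} := by
        apply closure_minimal
        · intro s hs; exact hs.1.le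
        · exact isClosed_le continuous_const Complex.continuous_re
      refine this.trans fun s hs => ?_
      simp only [Set.mem_ofPred_eq] at hs ⊢
      linarith)
    ⟨2 * B * Λ, by
      rintro _ ⟨z, hz, rfl⟩
      exact hstrip z hz.1 hz.2⟩
    (fun z hz => hstrip z (le_of_eq (by simpa using hz.symm)) (by
      have : z.re = Θ + η := by simpa using hz
      linarith))
    (fun z hz => hright z (by simpa using hz))
  have hG : G s₀ = J s₀ := by simp [G]
  rw [hG, hs₀re] at hmain
  refine hmain.trans (le_of_eq ?_)
  have hne : 1 - Θ ≠ 0 := by linarith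
  have e1 : 1 - (σ₀ - (Θ + η)) / (1 + η - (Θ + η)) = (1 + η - σ₀) / (1 - Θ) := by
    rw [show 1 + η - (Θ + η) = 1 - Θ by ring]; field_simp; ring
  rw [Real.mul_rpow (by positivity) (by positivity), mul_right_comm,
    ← Real.rpow_add (by positivity), sub_add_cancel, Real.rpow_one, e1]

lemma exp_compare (A ε : ℝ) (hA : 0 ≤ A) (hε : 0 < ε) :
    ∃ A', 0 ≤ A' ∧ ∀ L κ₀ κ : ℝ, 0 < L → 0 ≤ κ₀ → κ₀ ≤ 1 → κ₀ + ε ≤ κ →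
      A * L ^ κ₀ ≤ A' + L ^ κ := by
  set T := max 1 (A ^ (1 / ε))
  have hT1 : 1 ≤ T := le_max_left _ _
  have hTA : A ≤ T ^ ε := by
    calc A = (A ^ (1 / ε)) ^ ε := by
          rw [← Real.rpow_mul hA, one_div, inv_mul_cancel₀ hε.ne', Real.rpow_one]
      _ ≤ _ := by gcongr; exact le_max_right _ _
  refine ⟨A * T, by positivity, fun L κ₀ κ hL h0 h1 h2 => ?_⟩
  rcases le_total T L with h | h
  · have hL1 : 1 ≤ L := hT1.trans h
    calc A * L ^ κ₀ ≤ L ^ ε * L ^ κ₀ := by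
          gcongr
          exact hTA.trans (by gcongr)
      _ = L ^ (κ₀ + ε) := by rw [← Real.rpow_add hL, add_comm]
      _ ≤ L ^ κ := by gcongr
      _ ≤ _ := by have : 0 ≤ A * T := by positivity
                  linarith
  · have : L ^ κ₀ ≤ T := by
      calc L ^ κ₀ ≤ T ^ κ₀ := by gcongr
        _ ≤ T ^ (1:ℝ) := by gcongr
        _ = T := Real.rpow_one _
    have h4 : A * L ^ κ₀ ≤ A * T := by gcongr
    have : 0 ≤ L ^ κ := by positivity
    linarith

lemma final_bound (Θ : ℝ) (hΘ0 : 0 ≤ Θ) (hΘ1 : Θ < 1) (W J : ℂ → ℂ)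
    (hW : DifferentiableOn ℂ W {s | Θ < s.re})
    (hJ : DifferentiableOn ℂ J {s | Θ < s.re})
    (hode : ∀ s : ℂ, 1 < s.re → deriv W s = -(J s * W s))
    (hWb : ∀ δ > 0, ∃ C, ∀ s : ℂ, Θ + δ ≤ s.re → ‖W s‖ ≤ C * (1 + ‖s‖) ^ 2)
    (hJb : ∀ b > 1, ∃ K, ∀ s : ℂ, b ≤ s.re → ‖J s‖ ≤ K)
    (hup : ∀ b > 1, ∃ K, ∀ s : ℂ, b ≤ s.re → ‖W s‖ ≤ K * ‖s - 1‖)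
    (σ₁ : ℝ) (hσ₁ : 2 ≤ σ₁) (hlow : ∀ s : ℂ, σ₁ ≤ s.re → ‖s - 1‖ ≤ 2 * ‖W s‖) :
    (∀ s : ℂ, Θ < s.re → W s ≠ 0) ∧
    ∀ δ > 0, ∀ ε > 0, ∃ C : ℝ, 0 ≤ C ∧ ∀ σ t : ℝ, Θ + δ ≤ σ → 2 ≤ |t| →
      ‖W (σ + t * Complex.I)‖ ≤ C * Real.exp (Real.log |t| ^ ((1 - σ) / (1 - Θ) + ε))
        * ‖(σ + t * Complex.I : ℂ) - 1‖ ∧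
      ‖(σ + t * Complex.I : ℂ) - 1‖ ≤ C * Real.exp (Real.log |t| ^ ((1 - σ) / (1 - Θ) + ε))
        * ‖W (σ + t * Complex.I)‖ := by
  have hode' := ode_extend Θ hΘ1 W J hW hJ hode
  have hlog := log_bound Θ hΘ0 W J hW hJ hode' hWb hJb σ₁ hσ₁ hlow
  have hhor := horiz Θ W J hW hode'
  constructor
  · intro s hs h0
    -- J is bounded on the horizontal segment
    obtain ⟨C, hC⟩ := hlog (min s.re 2 - Θ) (by
      rcases min_choice s.re 2 with h | h <;> rw [h] <;> linarith)
    set y := max s.re σ₁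
    have hy : σ₁ ≤ y := le_max_right _ _
    have h1 := hhor s.im y s.re (C * Real.log (|s.im| + 3)) (by linarith) hs (by
      intro u hu
      apply hC
      rw [Set.uIcc_of_ge (le_max_left _ _)] at hu
      have := min_le_left s.re 2
      linarith [hu.1])
    rw [Complex.re_add_im, h0, norm_zero, zero_mul] at h1
    have h2 := hlow (y + s.im * Complex.I) (by simpa using hy)
    have h3 : y - 1 ≤ ‖((y:ℂ) + s.im * Complex.I) - 1‖ := by
      refine le_trans ?_ (Complex.re_le_norm _)
      simp
    linarith
  · intro δ hδ ε hε
    set η := min δ (ε * (1 - Θ) / 2)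
    have h1Θ : 0 < 1 - Θ := by linarith
    have hη : 0 < η := lt_min hδ (by positivity)
    have hηδ : η ≤ δ := min_le_left _ _
    have hηε : η / (1 - Θ) ≤ ε / 2 := by
      rw [div_le_iff₀ h1Θ]
      refine (min_le_right _ _).trans (le_of_eq (by ring))
    obtain ⟨CJ, hCJ0, hCJ⟩ := interp_bound Θ hΘ1 J hJ hJb hlog η hη
    obtain ⟨K, hK⟩ := hJb (1 + η) (by linarith)
    obtain ⟨K', hK'⟩ := hup (1 + η) (by linarith)
    set b := 1 + η
    -- lower bound to the right of b
    obtain ⟨k, hk0, hk⟩ : ∃ k : ℝ, 0 ≤ k ∧ ∀ σ t : ℝ, b ≤ σ →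
        ‖(σ + t * Complex.I : ℂ) - 1‖ ≤ k * ‖W (σ + t * Complex.I)‖ := by
      refine ⟨max 2 (2 * Real.exp (|K| * σ₁)), by positivity, fun σ t hσ => ?_⟩
      rcases le_or_gt σ₁ σ with h | h
      · refine (hlow _ (by simpa using h)).trans ?_
        gcongr
        exact le_max_left _ _
      · have h2 := hhor t σ₁ σ |K| (by linarith) (by simp only [b] at hσ; linarith) (by
          intro u hu
          rw [Set.uIcc_of_ge h.le] at hu
          exact (hK _ (by simpa using hσ.trans hu.1)).trans (le_abs_self K))
        have h3 := hlow (σ₁ + t * Complex.I) (by simp)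
        have h4 : ‖(σ + t * Complex.I : ℂ) - 1‖ ≤ ‖(σ₁ + t * Complex.I : ℂ) - 1‖ := by
          have hσ' : 1 ≤ σ := by simp only [b] at hσ; linarith
          refine (sq_le_sq₀ (norm_nonneg _) (norm_nonneg _)).1 ?_
          rw [Complex.sq_norm, Complex.sq_norm, Complex.normSq_apply, Complex.normSq_apply]
          simp
          nlinarith
        have h5 : |σ₁ - σ| ≤ σ₁ := by
          rw [abs_of_pos (by linarith)]; simp only [b] at hσ; linarith
        calc _ ≤ 2 * ‖W (σ₁ + t * Complex.I)‖ := h4.trans h3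
          _ ≤ 2 * (‖W (σ + t * Complex.I)‖ * Real.exp (|K| * |σ₁ - σ|)) := by gcongr
          _ ≤ 2 * (‖W (σ + t * Complex.I)‖ * Real.exp (|K| * σ₁)) := by gcongr
          _ = (2 * Real.exp (|K| * σ₁)) * ‖W (σ + t * Complex.I)‖ := by ring
          _ ≤ _ := by gcongr; exact le_max_right _ _
    obtain ⟨A', hA'0, hA'⟩ := exp_compare (CJ * 3 * (1 - Θ)) (ε / 2) (by positivity) (by positivity)
    set Q := |K'| + k
    have hQ0 : 0 ≤ Q := by positivity
    refine ⟨Q * (2 + η) * Real.exp A', by positivity, fun σ t hσ ht => ?_⟩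
    set L := Real.log |t|
    have hL : 0 < L := Real.log_pos (by linarith)
    set κ := (1 - σ) / (1 - Θ) + ε
    set s : ℂ := σ + t * Complex.I
    have hA'1 : 1 ≤ Real.exp A' := Real.one_le_exp hA'0
    have hLe : 1 ≤ Real.exp (L ^ κ) := Real.one_le_exp (by positivity)
    rcases le_or_gt b σ with h | h
    · have h2 : Q * 1 * 1 * 1 ≤ Q * (2 + η) * Real.exp A' * Real.exp (L ^ κ) := by
        gcongr; linarith
      rw [mul_one, mul_one, mul_one] at h2
      constructor
      · refine (hK' s (by simpa [s] using h)).trans ?_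
        gcongr
        refine le_trans ?_ h2
        have := le_abs_self K'
        simp only [Q]; linarith
      · refine (hk σ t h).trans ?_
        gcongr
        refine le_trans ?_ h2
        have := abs_nonneg K'
        simp only [Q]; linarith
    · set κ₀ := (1 + η - σ) / (1 - Θ)
      have hκ₀0 : 0 ≤ κ₀ := div_nonneg (by simp only [b] at h; linarith) h1Θ.le
      have hκ₀1 : κ₀ ≤ 1 := by rw [div_le_one h1Θ]; linarith
      have hκ : κ₀ + ε / 2 ≤ κ := by
        have : κ₀ = (1 - σ) / (1 - Θ) + η / (1 - Θ) := by simp only [κ₀]; rw [← add_div]; congr 1; ring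
        simp only [κ]; linarith
      have hΛ1 := one_le_Lam t
      have hΛL : Real.log (|t| + 3) ≤ 3 * L := by
        have h3 : |t| + 3 ≤ |t| ^ 3 := by nlinarith [mul_nonneg (by linarith : 0 ≤ |t| - 2) (by linarith : 0 ≤ |t| - 2)]
        have := Real.log_le_log (by positivity) h3
        rwa [Real.log_pow] at this
      have hΛκ : Real.log (|t| + 3) ^ κ₀ ≤ 3 * L ^ κ₀ := by
        calc _ ≤ (3 * L) ^ κ₀ := by gcongr
          _ = 3 ^ κ₀ * L ^ κ₀ := Real.mul_rpow (by norm_num) hL.le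
          _ ≤ 3 ^ (1:ℝ) * L ^ κ₀ := by gcongr; norm_num
          _ = _ := by rw [Real.rpow_one]
      have hbnd : ∀ u : ℝ, σ ≤ u → u ≤ b →
          ‖J (u + t * Complex.I)‖ ≤ CJ * Real.log (|t| + 3) ^ κ₀ := by
        intro u hu1 hu2
        refine (hCJ u t (by linarith) hu2).trans ?_
        gcongr
        simp only [κ₀, b]; gcongr
      set KK := CJ * Real.log (|t| + 3) ^ κ₀
      have hKK : Real.exp (KK * |σ - b|) ≤ Real.exp A' * Real.exp (L ^ κ) := by
        rw [← Real.exp_add]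
        apply Real.exp_le_exp.2
        have h3 : |σ - b| ≤ 1 - Θ := by
          rw [abs_of_neg (by linarith)]; simp only [b]; linarith
        calc KK * |σ - b| ≤ (CJ * (3 * L ^ κ₀)) * (1 - Θ) := by
              simp only [KK]; gcongr
          _ = CJ * 3 * (1 - Θ) * L ^ κ₀ := by ring
          _ ≤ _ := hA' L κ₀ κ hL hκ₀0 hκ₀1 hκ
      have hσΘ : Θ < σ := by linarith
      have hbΘ : Θ < b := by simp only [b]; linarith
      have g1 := hhor t σ b KK hσΘ hbΘ (fun u hu => by
        rw [Set.uIcc_of_le h.le] at hu; exact hbnd u hu.1 hu.2)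
      have g2 := hhor t b σ KK hbΘ hσΘ (fun u hu => by
        rw [Set.uIcc_of_ge h.le] at hu; exact hbnd u hu.1 hu.2)
      rw [abs_sub_comm] at g2
      have hnorm : ∀ x : ℝ, |x - 1| ≤ 1 + η → |t| ≤ ‖(x + t * Complex.I : ℂ) - 1‖ ∧
          ‖(x + t * Complex.I : ℂ) - 1‖ ≤ (2 + η) * |t| := by
        intro x hx
        constructor
        · have := Complex.abs_im_le_norm ((x + t * Complex.I : ℂ) - 1)
          simpa using this
        · have := Complex.norm_le_abs_re_add_abs_im ((x + t * Complex.I : ℂ) - 1)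
          simp at this
          nlinarith
      have n1 := hnorm σ (by rw [abs_le]; simp only [b] at h; constructor <;> linarith)
      have n2 := hnorm b (by rw [abs_le]; simp only [b]; constructor <;> linarith)
      have hKb := hK' (b + t * Complex.I) (by simp)
      have hkb := hk b t le_rfl
      constructor
      · calc ‖W s‖ ≤ ‖W (b + t * Complex.I)‖ * Real.exp (KK * |σ - b|) := g1
          _ ≤ (Q * ((2 + η) * ‖s - 1‖)) * (Real.exp A' * Real.exp (L ^ κ)) := by
            gcongr
            calc _ ≤ K' * ‖(b + t * Complex.I : ℂ) - 1‖ := hKb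
              _ ≤ Q * ((2 + η) * |t|) := by
                have := le_abs_self K'
                gcongr
                · simp only [Q]; linarith
                · exact n2.2
              _ ≤ _ := by gcongr; exact n1.1
          _ = _ := by ring
      · calc ‖s - 1‖ ≤ (2 + η) * |t| := n1.2
          _ ≤ (2 + η) * (Q * ‖W (b + t * Complex.I)‖) := by
            gcongr
            refine n2.1.trans (hkb.trans ?_)
            have := abs_nonneg K'
            gcongr
            simp only [Q]; linarith
          _ ≤ (2 + η) * (Q * (‖W s‖ * (Real.exp A' * Real.exp (L ^ κ)))) := by
            have := g2.trans (mul_le_mul_of_nonneg_left hKK (norm_nonneg _))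
            gcongr
          _ = _ := by ring

lemma norm_term (n w b : ℝ) (hn : 1 ≤ n) (hw : 0 ≤ w) (s : ℂ) (hs : b ≤ s.re) :
    ‖(w : ℂ) * (n : ℂ) ^ (-s)‖ ≤ w * n ^ (-b) := by
  rw [norm_mul, Complex.norm_real, Real.norm_of_nonneg hw,
    Complex.norm_cpow_eq_rpow_re_of_pos (by linarith)]
  gcongr
  simpa using hs

lemma series_bound {ι : Type*} (n w : ι → ℝ) (hn : ∀ j, 1 ≤ n j) (hw : ∀ j, 0 ≤ w j)
    (hsum : ∀ σ : ℝ, 1 < σ → Summable (fun j => w j * n j ^ (-σ))) (F : ℂ → ℂ)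
    (hF : ∀ s : ℂ, 1 < s.re → HasSum (fun j => (w j : ℂ) * (n j : ℂ) ^ (-s)) (F s)) :
    ∀ b > 1, ∃ K, ∀ s : ℂ, b ≤ s.re → ‖F s‖ ≤ K := by
  intro b hb
  refine ⟨∑' j, w j * n j ^ (-b), fun s hs => ?_⟩
  exact (hF s (lt_of_lt_of_le hb hs)).norm_le_of_bounded (hsum b hb).hasSum
    fun j => norm_term _ _ _ (hn j) (hw j) s hs

lemma zeta_deriv (p : ℕ → ℝ) (hp : ∀ i, 1 < p i) (Z Ψ : ℂ → ℂ)
    (hs1 : ∀ σ : ℝ, 1 < σ → Summable (fun e => (1:ℝ) * nn p e ^ (-σ)))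
    (hs2 : ∀ σ : ℝ, 1 < σ → Summable (fun ik : ℕ × ℕ =>
      Real.log (p ik.1) * (p ik.1 ^ (ik.2 + 1)) ^ (-σ)))
    (hZ : ∀ s : ℂ, 1 < s.re → HasSum (fun e => (nn p e : ℂ) ^ (-s)) (Z s))
    (hΨ : ∀ s : ℂ, 1 < s.re → HasSum (fun ik : ℕ × ℕ =>
      (Real.log (p ik.1) : ℂ) * ((p ik.1 ^ (ik.2 + 1) : ℝ) : ℂ) ^ (-s)) (Ψ s))
    (s : ℂ) (hs : 1 < s.re) : deriv Z s = -(Z s * Ψ s) := by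
  have hpos : ∀ e, 0 < nn p e := fun e => by linarith [nn_ge p hp e]
  have hnz : ∀ e, (nn p e : ℂ) ≠ 0 := fun e => by exact_mod_cast (hpos e).ne'
  obtain ⟨b, hb1, hb2⟩ := exists_between hs
  have hopen : IsOpen {z : ℂ | b < z.re} := isOpen_lt continuous_const Complex.continuous_re
  have hbd : ∀ e (z : ℂ), b ≤ z.re → ‖(nn p e : ℂ) ^ (-z)‖ ≤ 1 * nn p e ^ (-b) := by
    intro e z hz
    have := norm_term (nn p e) 1 b (nn_ge p hp e) zero_le_one z hz
    simpa using this
  have hdt : ∀ e (z : ℂ), HasDerivAt (fun z : ℂ => (nn p e : ℂ) ^ (-z))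
      (-((Real.log (nn p e) : ℂ) * (nn p e : ℂ) ^ (-z))) z := by
    intro e z
    have h := (hasDerivAt_neg z).const_cpow (c := (nn p e : ℂ)) (Or.inl (hnz e))
    convert h using 1
    rw [Complex.ofReal_log (hpos e).le]
    ring
  have h1 := Complex.hasSum_deriv_of_summable_norm (F := fun e (z : ℂ) => (nn p e : ℂ) ^ (-z))
    (U := {z : ℂ | b < z.re}) (hs1 b hb1)
    (fun e z _ => (hdt e z).differentiableAt.differentiableWithinAt) hopen
    (fun e z hz => hbd e z (le_of_lt hz)) hb2
  have h2 : deriv (fun w : ℂ => ∑' e, (nn p e : ℂ) ^ (-w)) s = deriv Z s := by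
    apply Filter.EventuallyEq.deriv_eq
    filter_upwards [hopen.mem_nhds hb2] with z hz
    exact (hZ z (hb1.trans hz)).tsum_eq
  rw [h2] at h1
  have h3 := conv_sum p hp s
    ((hs1 b hb1).of_nonneg_of_le (fun _ => norm_nonneg _) fun e => hbd e s hb2.le)
    ((hs2 b hb1).of_nonneg_of_le (fun _ => norm_nonneg _) fun ik =>
      norm_term _ _ b (one_le_pow₀ (hp _).le) (Real.log_nonneg (hp _).le) s hb2.le)
    _ _ (hZ s hs) (hΨ s hs)
  refine h1.unique ?_
  convert h3.neg using 2 with e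
  exact (hdt e s).deriv

lemma zeta_low (p : ℕ → ℝ) (hmono : Monotone p) (hp0 : 1 < p 0) (Z : ℂ → ℂ)
    (hs1 : ∀ σ : ℝ, 1 < σ → Summable (fun e => (1:ℝ) * nn p e ^ (-σ)))
    (hZ : ∀ s : ℂ, 1 < s.re → HasSum (fun e => (nn p e : ℂ) ^ (-s)) (Z s)) :
    ∃ σ₁ : ℝ, 2 ≤ σ₁ ∧ ∀ s : ℂ, σ₁ ≤ s.re → 1 ≤ 2 * ‖Z s‖ := by
  have hp : ∀ i, 1 < p i := fun i => hp0.trans_le (hmono (Nat.zero_le i))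
  set S := ∑' e, (1:ℝ) * nn p e ^ (-(2:ℝ))
  have hS : HasSum (fun e => (1:ℝ) * nn p e ^ (-(2:ℝ))) S := (hs1 2 (by norm_num)).hasSum
  have hS0 : 0 ≤ S := hS.nonneg fun e => by
    have := nn_ge p hp e
    positivity
  obtain ⟨m, hm⟩ := pow_unbounded_of_one_lt (2 * S) hp0
  refine ⟨2 + m, by linarith [m.cast_nonneg (α := ℝ)], fun s hs => ?_⟩
  have hs' : 1 < s.re := by linarith [m.cast_nonneg (α := ℝ)]
  have hpm : 0 < p 0 ^ m := pow_pos (by linarith) m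
  have h1 : HasSum (fun e => if e = 0 then 0 else (nn p e : ℂ) ^ (-s)) (Z s - 1) := by
    have h := (hZ s hs').sub (hasSum_ite_eq (0 : ℕ →₀ ℕ) (1:ℂ))
    have hfun : (fun e => if e = 0 then 0 else (nn p e : ℂ) ^ (-s)) =
        fun e => (nn p e : ℂ) ^ (-s) - if e = 0 then 1 else 0 := by
     funext e
     split_ifs with he
     · subst he; simp [nn_zero]
     · simp
    rw [hfun]; exact h
  have h2 : ‖Z s - 1‖ ≤ (p 0 ^ m)⁻¹ * S := by
    refine h1.norm_le_of_bounded (hS.mul_left _) fun e => ?_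
    have hn := nn_ge p hp e
    split_ifs with he
    · rw [norm_zero]; positivity
    · have hge : p 0 ≤ nn p e := by
        obtain ⟨i, hi⟩ : ∃ i, e i ≠ 0 := by
          by_contra hcon
          push Not at hcon
          exact he (Finsupp.ext hcon)
        refine (hmono (Nat.zero_le i)).trans (le_trans ?_ (nn_ge_pow p hp e i))
        exact le_self_pow₀ (hp i).le hi
      rw [Complex.norm_cpow_eq_rpow_re_of_pos (by linarith), Complex.neg_re]
      calc nn p e ^ (-s.re) ≤ nn p e ^ (-(m:ℝ) + -2) := by gcongr; linarith
        _ = (nn p e ^ m)⁻¹ * nn p e ^ (-(2:ℝ)) := by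
          rw [Real.rpow_add (by linarith), Real.rpow_neg (by linarith), Real.rpow_natCast]
        _ ≤ _ := by rw [one_mul]; gcongr
  have h3 : (p 0 ^ m)⁻¹ * S ≤ 1 / 2 := by
    rw [inv_mul_le_iff₀ hpm]; linarith
  have h4 := norm_sub_norm_le (1:ℂ) (1 - Z s)
  rw [norm_one, sub_sub_cancel, norm_sub_rev] at h4
  linarith

/-- The theorem with real exponents `ε` in the last clause. -/
theorem stmt8_real (p : ℕ → ℝ) (hmono : Monotone p) (hp0 : 1 < p 0)
    (htop : Tendsto p atTop atTop) (ρ : ℝ) (hρ : 0 < ρ)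
    (α β : ℝ) (hα : α ∈ Set.Ico (0:ℝ) 1) (hβ : β ∈ Set.Ico (0:ℝ) 1)
    (hψ : ∀ ε > 0, (fun x => psiP p x - x) =O[atTop] fun x => x ^ (α + ε))
    (hN : ∀ ε > 0, (fun x => (NP p x : ℝ) - ρ * x) =O[atTop] fun x => x ^ (β + ε))
    (Θ : ℝ) (hΘ : Θ = max α β) :
    ∃ Z : ℂ → ℂ, DifferentiableOn ℂ Z ({s : ℂ | Θ < s.re} \ {1}) ∧
      (∀ s ∈ ({s : ℂ | Θ < s.re} \ {1} : Set ℂ), Z s ≠ 0) ∧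
      AgreesWithZeta p Z ∧
      (∀ δ > 0, ∀ ε > 0, ∃ C : ℝ, ∀ σ t : ℝ, Θ + δ ≤ σ → 2 ≤ |t| →
        ‖Z (σ + t * Complex.I)‖
          ≤ C * Real.exp (Real.log |t| ^ ((1 - σ) / (1 - Θ) + ε)) ∧
        ‖1 / Z (σ + t * Complex.I)‖
          ≤ C * Real.exp (Real.log |t| ^ ((1 - σ) / (1 - Θ) + ε))) ∧
      (∀ σ : ℝ, Θ < σ → ∀ ε : ℝ, 0 < ε →
        ((fun t : ℝ => Z (σ + t * Complex.I)) =O[cocompact ℝ] fun t => |t| ^ ε) ∧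
        ((fun t : ℝ => 1 / Z (σ + t * Complex.I)) =O[cocompact ℝ] fun t => |t| ^ ε)) := by
  have hp : ∀ i, 1 < p i := fun i => hp0.trans_le (hmono (Nat.zero_le i))
  have hαΘ : α ≤ Θ := hΘ ▸ le_max_left _ _
  have hβΘ : β ≤ Θ := hΘ ▸ le_max_right _ _
  have hΘ0 : 0 ≤ Θ := hα.1.trans hαΘ
  have hΘ1 : Θ < 1 := hΘ ▸ max_lt hα.2 hβ.2
  obtain ⟨hs1, E1, hE1, hE1b, hE1s⟩ := mellin_lemma (nn p) (fun _ => (1:ℝ)) (nn_ge p hp)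
    (fun _ => zero_le_one) (fun x => (NP p x : ℝ)) (hasSum_NP p hmono hp0 htop) ρ β hβ.1 hβ.2 hN
  obtain ⟨hs2, E2, hE2, hE2b, hE2s⟩ := mellin_lemma
    (fun ik : ℕ × ℕ => p ik.1 ^ (ik.2 + 1)) (fun ik => Real.log (p ik.1))
    (fun ik => one_le_pow₀ (hp _).le) (fun ik => Real.log_nonneg (hp _).le)
    (psiP p) (hasSum_psiP p hmono hp0 htop) 1 α hα.1 hα.2 (by simpa using hψ)
  replace hE1 : DifferentiableOn ℂ E1 {s | Θ < s.re} :=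
    hE1.mono fun s hs => lt_of_le_of_lt hβΘ hs
  replace hE2 : DifferentiableOn ℂ E2 {s | Θ < s.re} :=
    hE2.mono fun s hs => lt_of_le_of_lt hαΘ hs
  set Z : ℂ → ℂ := fun s => ρ * s / (s - 1) + s * E1 s with hZdef
  set Ψ : ℂ → ℂ := fun s => (1:ℝ) * s / (s - 1) + s * E2 s with hΨdef
  set W : ℂ → ℂ := fun s => ρ * s + s * (s - 1) * E1 s with hWdef
  set J : ℂ → ℂ := fun s => 1 + s * E2 s with hJdef
  have hZs : ∀ s : ℂ, 1 < s.re → HasSum (fun e => (nn p e : ℂ) ^ (-s)) (Z s) := by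
    intro s hs
    simpa using hE1s s hs
  have hne : ∀ s : ℂ, 1 < s.re → s - 1 ≠ 0 := by
    intro s hs h
    rw [sub_eq_zero] at h
    rw [h] at hs
    simp at hs
  have hWZ : ∀ s : ℂ, s - 1 ≠ 0 → W s = (s - 1) * Z s := by
    intro s hs
    simp only [hWdef, hZdef]
    field_simp
  have hJΨ : ∀ s : ℂ, s - 1 ≠ 0 → J s = Ψ s - 1 / (s - 1) := by
    intro s hs
    simp only [hJdef, hΨdef]
    field_simp
    push_cast
    ring
  have hW : DifferentiableOn ℂ W {s | Θ < s.re} := by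
    simp only [hWdef]; fun_prop
  have hJ : DifferentiableOn ℂ J {s | Θ < s.re} := by
    simp only [hJdef]; fun_prop
  have hopen : IsOpen {z : ℂ | Θ < z.re} := isOpen_lt continuous_const Complex.continuous_re
  have hZd : DifferentiableOn ℂ Z ({s : ℂ | Θ < s.re} \ {1}) := by
    have h1 := hE1.mono (Set.sdiff_subset (t := {(1:ℂ)}))
    have h2 : ∀ s ∈ ({s : ℂ | Θ < s.re} \ {1} : Set ℂ), s - 1 ≠ 0 :=
      fun s hs => sub_ne_zero.2 hs.2
    simp only [hZdef]
    fun_prop (disch := assumption)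
  have hode : ∀ s : ℂ, 1 < s.re → deriv W s = -(J s * W s) := by
    intro s hs
    have h1 := zeta_deriv p hp Z Ψ hs1 hs2 hZs hE2s s hs
    have hs1' : s - 1 ≠ 0 := hne s hs
    have hZds : DifferentiableAt ℂ Z s := hZd.differentiableAt
      ((hopen.sdiff isClosed_singleton).mem_nhds ⟨hΘ1.trans hs, sub_ne_zero.1 hs1'⟩)
    have h2 : W =ᶠ[nhds s] fun z => (z - 1) * Z z := by
      filter_upwards [isOpen_ne.mem_nhds (sub_ne_zero.1 hs1')] with z hz
      exact hWZ z (sub_ne_zero.2 hz)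
    have h3 : HasDerivAt (fun z => (z - 1) * Z z) (1 * Z s + (s - 1) * deriv Z s) s :=
      ((hasDerivAt_id s).sub_const 1).mul hZds.hasDerivAt
    rw [h2.deriv_eq, h3.deriv, h1, hWZ s hs1', hJΨ s hs1']
    field_simp
    ring
  have hWb : ∀ δ > 0, ∃ C, ∀ s : ℂ, Θ + δ ≤ s.re → ‖W s‖ ≤ C * (1 + ‖s‖) ^ 2 := by
    intro δ hδ
    obtain ⟨C, hC⟩ := hE1b δ hδ
    refine ⟨ρ + |C|, fun s hs => ?_⟩
    have h1 : ‖E1 s‖ ≤ |C| := (hC s (by linarith)).trans (le_abs_self _)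
    have h2 : ‖s - 1‖ ≤ 1 + ‖s‖ := by
      have := norm_sub_le s 1
      rw [norm_one] at this; linarith
    have h0 := norm_nonneg s
    calc ‖W s‖ ≤ ‖(ρ:ℂ) * s‖ + ‖s * (s - 1) * E1 s‖ := norm_add_le _ _
      _ = ρ * ‖s‖ + ‖s‖ * ‖s - 1‖ * ‖E1 s‖ := by
        rw [norm_mul, norm_mul, norm_mul, Complex.norm_real, Real.norm_of_nonneg hρ.le]
      _ ≤ ρ * (1 + ‖s‖) ^ 2 + (1 + ‖s‖) * (1 + ‖s‖) * |C| := by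
        gcongr
        · nlinarith
        · linarith
      _ = _ := by ring
  have hJb : ∀ b > 1, ∃ K, ∀ s : ℂ, b ≤ s.re → ‖J s‖ ≤ K := by
    intro b hb
    obtain ⟨K, hK⟩ := series_bound (fun ik : ℕ × ℕ => p ik.1 ^ (ik.2 + 1))
      (fun ik => Real.log (p ik.1)) (fun ik => one_le_pow₀ (hp _).le)
      (fun ik => Real.log_nonneg (hp _).le) hs2 Ψ hE2s b hb
    refine ⟨K + 1 / (b - 1), fun s hs => ?_⟩
    rw [hJΨ s (hne s (by linarith))]
    refine (norm_sub_le _ _).trans (add_le_add (hK s hs) ?_)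
    rw [norm_div, norm_one]
    have h1 : b - 1 ≤ ‖s - 1‖ := by
      refine le_trans ?_ (Complex.re_le_norm _)
      simpa using hs
    have : 0 < b - 1 := by linarith
    gcongr
  have hup : ∀ b > 1, ∃ K, ∀ s : ℂ, b ≤ s.re → ‖W s‖ ≤ K * ‖s - 1‖ := by
    intro b hb
    obtain ⟨K, hK⟩ := series_bound (nn p) (fun _ => (1:ℝ)) (nn_ge p hp)
      (fun _ => zero_le_one) hs1 Z hE1s b hb
    refine ⟨K, fun s hs => ?_⟩
    rw [hWZ s (hne s (by linarith)), norm_mul, mul_comm]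
    gcongr
    exact hK s hs
  obtain ⟨σ₁, hσ₁, hlow⟩ := zeta_low p hmono hp0 Z hs1 hZs
  obtain ⟨hnz, hbd⟩ := final_bound Θ hΘ0 hΘ1 W J hW hJ hode hWb hJb hup σ₁ hσ₁ (by
    intro s hs
    rw [hWZ s (hne s (by linarith)), norm_mul]
    have := hlow s hs
    nlinarith [norm_nonneg (s - 1)])
  have hmain : ∀ δ > 0, ∀ ε > 0, ∃ C : ℝ, 0 ≤ C ∧ ∀ σ t : ℝ, Θ + δ ≤ σ → 2 ≤ |t| →
        ‖Z (σ + t * Complex.I)‖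
          ≤ C * Real.exp (Real.log |t| ^ ((1 - σ) / (1 - Θ) + ε)) ∧
        ‖1 / Z (σ + t * Complex.I)‖
          ≤ C * Real.exp (Real.log |t| ^ ((1 - σ) / (1 - Θ) + ε)) := by
    intro δ hδ ε hε
    obtain ⟨C, hC0, hC⟩ := hbd δ hδ ε hε
    refine ⟨C, hC0, fun σ t hσ ht => ?_⟩
    obtain ⟨h1, h2⟩ := hC σ t hσ ht
    set s : ℂ := σ + t * Complex.I
    have hs1' : s - 1 ≠ 0 := by
      intro h
      have : (s - 1).im = t := by simp [s]
      rw [h] at this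
      simp at this
      rw [← this] at ht
      norm_num at ht
    have hpos : 0 < ‖s - 1‖ := norm_pos_iff.2 hs1'
    have hWs : W s ≠ 0 := hnz s (by simp [s]; linarith)
    rw [hWZ s hs1'] at hWs
    have hZ0 : 0 < ‖Z s‖ := norm_pos_iff.2 (right_ne_zero_of_mul hWs)
    rw [hWZ s hs1', norm_mul] at h1 h2
    constructor
    · rw [mul_comm] at h1
      exact le_of_mul_le_mul_right h1 hpos
    · rw [norm_div, norm_one, div_le_iff₀ hZ0]
      refine le_of_mul_le_mul_right ?_ hpos
      linarith
  refine ⟨Z, hZd, ?_, hZs, ?_, ?_⟩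
  · intro s hs h0
    have := hnz s hs.1
    rw [hWZ s (sub_ne_zero.2 hs.2), h0, mul_zero] at this
    exact this rfl
  · intro δ hδ ε hε
    obtain ⟨C, -, hC⟩ := hmain δ hδ ε hε
    exact ⟨C, hC⟩
  · intro σ hσ ε hε
    have h1Θ : 0 < 1 - Θ := by linarith
    set ε' := (σ - Θ) / (1 - Θ) / 2 with hε'
    have hε'0 : 0 < ε' := div_pos (div_pos (by linarith) h1Θ) two_pos
    obtain ⟨C, hC0, hC⟩ := hmain (σ - Θ) (by linarith) ε' hε'0
    set κ := (1 - σ) / (1 - Θ) + ε' with hκ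
    have hκ1 : κ < 1 := by
      have : (1 - σ) / (1 - Θ) + (σ - Θ) / (1 - Θ) = 1 := by
        rw [← add_div]; field_simp; ring
      simp only [hκ]; linarith
    have hlit : (fun x : ℝ => x ^ κ) =o[atTop] fun x => x := by
      rw [isLittleO_iff_tendsto' ((eventually_gt_atTop 0).mono fun x hx h => absurd h hx.ne')]
      refine (tendsto_rpow_neg_atTop (y := 1 - κ) (by linarith)).congr' ?_
      filter_upwards [eventually_gt_atTop 0] with x hx
      rw [neg_sub, Real.rpow_sub hx, Real.rpow_one]
    have hlog : ∀ᶠ x : ℝ in atTop, Real.log x ^ κ ≤ ε * Real.log x := by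
      have h1 := Real.tendsto_log_atTop.eventually (hlit.bound hε)
      filter_upwards [h1, eventually_ge_atTop 1] with x hx hx1
      have := Real.log_nonneg hx1
      rw [Real.norm_of_nonneg (by positivity), Real.norm_of_nonneg this] at hx
      exact hx
    have hev : ∀ᶠ t : ℝ in cocompact ℝ, 2 ≤ |t| ∧ Real.log |t| ^ κ ≤ ε * Real.log |t| :=
      (tendsto_norm_cocompact_atTop (E := ℝ)).eventually
        ((eventually_ge_atTop 2).and hlog)
    have hfin : ∀ᶠ t : ℝ in cocompact ℝ, ‖Z (σ + t * Complex.I)‖ ≤ C * ‖|t| ^ ε‖ ∧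
        ‖1 / Z (σ + t * Complex.I)‖ ≤ C * ‖|t| ^ ε‖ := by
      filter_upwards [hev] with t ht
      have h1 : Real.exp (Real.log |t| ^ κ) ≤ ‖|t| ^ ε‖ := by
        rw [Real.norm_of_nonneg (by positivity), Real.rpow_def_of_pos (x := |t|) (by linarith [ht.1])]
        apply Real.exp_le_exp.2
        linarith [ht.2]
      obtain ⟨h2, h3⟩ := hC σ t (by linarith) ht.1
      exact ⟨h2.trans (by gcongr), h3.trans (by gcongr)⟩
    exact ⟨IsBigO.of_bound C (hfin.mono fun t h => h.1),
      IsBigO.of_bound C (hfin.mono fun t h => h.2)⟩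

theorem stmt8 (p : ℕ → ℝ) (hmono : Monotone p) (hp0 : 1 < p 0)
    (htop : Tendsto p atTop atTop) (ρ : ℝ) (hρ : 0 < ρ)
    (α β : ℝ) (hα : α ∈ Set.Ico (0:ℝ) 1) (hβ : β ∈ Set.Ico (0:ℝ) 1)
    (hψ : ∀ ε > 0, (fun x => psiP p x - x) =O[atTop] fun x => x ^ (α + ε))
    (hN : ∀ ε > 0, (fun x => (NP p x : ℝ) - ρ * x) =O[atTop] fun x => x ^ (β + ε))
    (Θ : ℝ) (hΘ : Θ = max α β) :
    ∃ Z : ℂ → ℂ, DifferentiableOn ℂ Z ({s : ℂ | Θ < s.re} \ {1}) ∧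
      (∀ s ∈ ({s : ℂ | Θ < s.re} \ {1} : Set ℂ), Z s ≠ 0) ∧
      AgreesWithZeta p Z ∧
      (∀ δ > 0, ∀ ε > 0, ∃ C : ℝ, ∀ σ t : ℝ, Θ + δ ≤ σ → 2 ≤ |t| →
        ‖Z (σ + t * Complex.I)‖
          ≤ C * Real.exp (Real.log |t| ^ ((1 - σ) / (1 - Θ) + ε)) ∧
        ‖1 / Z (σ + t * Complex.I)‖
          ≤ C * Real.exp (Real.log |t| ^ ((1 - σ) / (1 - Θ) + ε))) ∧
      (∀ σ : ℝ, Θ < σ → ∀ ε > 0,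
        ((fun t : ℝ => Z (σ + t * Complex.I)) =O[cocompact ℝ] fun t => |t| ^ ε) ∧
        ((fun t : ℝ => 1 / Z (σ + t * Complex.I)) =O[cocompact ℝ] fun t => |t| ^ ε)) := by
  obtain ⟨Z, h1, h2, h3, h4, h5⟩ :=
    stmt8_real p hmono hp0 htop ρ hρ α β hα hβ hψ hN Θ hΘ
  refine ⟨Z, h1, h2, h3, h4, fun σ hσ ε hε => ?_⟩
  have := h5 σ hσ ε (by exact_mod_cast hε)
  simpa only [Real.rpow_natCast] using this
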